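/- Let A be a q×n complex matrix, W a nonzero n×q complex matrix, m a positive integer, and k = max(Ind(AW), Ind(WA)). Then the null space of A^{Ⓦ_m,W,†} equals the null space of ((WA)^k)^* · (WA)^{m+1} · A^†, where A^{Ⓦ_m,W,†} = W·A^{Ⓦ_m,W}·W·A·A^† and ^* denotes conjugate transpose. -/

import Mathlib

open Matrix

/-- Index of a square matrix: least `d` with `rank (B^d) = rank (B^(d+1))`. -/
noncomputable def matInd {ι : Type*} [Fintype ι] [DecidableEq ι] (B : Matrix ι ι ℂ) : ℕ :=
  sInf {d : ℕ | (B ^ d).rank = (B ^ (d + 1)).rank}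

/-- `X` is the Moore-Penrose inverse of `A` (four Penrose equations). -/
noncomputable def IsMP {ι κ : Type*} [Fintype ι] [Fintype κ] (A : Matrix ι κ ℂ) (X : Matrix κ ι ℂ) : Prop :=
  A * X * A = A ∧ X * A * X = X ∧ (A * X)ᴴ = A * X ∧ (X * A)ᴴ = X * A

/-- Column space (range) of a matrix. -/
noncomputable def mrange {ι κ : Type*} [Fintype κ] (M : Matrix ι κ ℂ) : Submodule ℂ (ι → ℂ) :=
  LinearMap.range M.mulVecLin

/-- Null space of a matrix. -/
noncomputable def mker {ι κ : Type*} [Fintype κ] (M : Matrix ι κ ℂ) : Submodule ℂ (κ → ℂ) :=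
  LinearMap.ker M.mulVecLin

/-- `X` is the core-EP inverse of `B`. -/
noncomputable def IsCoreEP {ι : Type*} [Fintype ι] [DecidableEq ι] (B X : Matrix ι ι ℂ) : Prop :=
  X * B * X = X ∧ mrange X = mrange (B ^ matInd B) ∧ mrange Xᴴ = mrange (B ^ matInd B)

/-- `X` is the Drazin inverse of `B`. -/
noncomputable def IsDrazin {ι : Type*} [Fintype ι] [DecidableEq ι] (B X : Matrix ι ι ℂ) : Prop :=
  X * B * X = X ∧ B * X = X * B ∧ B ^ (matInd B + 1) * X = B ^ matInd B

/-- `X` is the group inverse of `B`. -/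
noncomputable def IsGroupInv {ι : Type*} [Fintype ι] (B X : Matrix ι ι ℂ) : Prop :=
  B * X * B = B ∧ X * B * X = X ∧ B * X = X * B

/-- Frobenius norm of a matrix. -/
noncomputable def frobNorm {ι κ : Type*} [Fintype ι] [Fintype κ] (M : Matrix ι κ ℂ) : ℝ :=
  Real.sqrt (∑ i, ∑ j, ‖M i j‖ ^ 2)

/-- A column space inclusion yields a factorization. -/
theorem exists_eq_mul_of_mrange_le {ι κ l : Type*} [Fintype κ] [Fintype l] [DecidableEq l]
    {M : Matrix ι l ℂ} {N : Matrix ι κ ℂ} (h : mrange M ≤ mrange N) :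
    ∃ Z : Matrix κ l ℂ, M = N * Z := by
  have hcol : ∀ j, ∃ v, N *ᵥ v = M.col j := fun j => by
    obtain ⟨v, hv⟩ := h ⟨Pi.single j 1, rfl⟩
    exact ⟨v, by simpa using hv⟩
  choose v hv using hcol
  refine ⟨(Matrix.of v)ᵀ, ?_⟩
  ext i j
  exact (congrFun (hv j) i).symm

theorem mrange_mul_le {ι κ l : Type*} [Fintype κ] [Fintype l]
    (M : Matrix ι κ ℂ) (N : Matrix κ l ℂ) : mrange (M * N) ≤ mrange M := by
  rintro _ ⟨v, rfl⟩
  exact ⟨N *ᵥ v, by simp⟩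

theorem mker_le_mker_mul {ι κ l : Type*} [Fintype κ] [Fintype l]
    (M : Matrix ι κ ℂ) (N : Matrix κ l ℂ) : mker N ≤ mker (M * N) := by
  intro v hv
  have hv' : N *ᵥ v = 0 := hv
  change (M * N) *ᵥ v = 0
  rw [← Matrix.mulVec_mulVec, hv', Matrix.mulVec_zero]

section Index

variable {ι : Type*} [Fintype ι] [DecidableEq ι]

theorem rank_pow_matInd (B : Matrix ι ι ℂ) :
    (B ^ matInd B).rank = (B ^ (matInd B + 1)).rank := by
  refine Nat.sInf_mem (s := {d : ℕ | (B ^ d).rank = (B ^ (d + 1)).rank}) ?_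
  by_contra h
  refine not_strictAnti_of_wellFoundedLT (fun d : ℕ => (B ^ d).rank)
    (strictAnti_nat_of_succ_lt fun d => lt_of_le_of_ne ?_ fun hd => h ⟨d, hd.symm⟩)
  rw [pow_succ]
  exact Matrix.rank_mul_le_left _ _

theorem mrange_pow_matInd_succ (B : Matrix ι ι ℂ) :
    mrange (B ^ (matInd B + 1)) = mrange (B ^ matInd B) :=
  Submodule.eq_of_le_of_finrank_eq (pow_succ B _ ▸ mrange_mul_le _ _) (rank_pow_matInd B).symm

theorem exists_pow_matInd_eq_pow_mul (B : Matrix ι ι ℂ) {k : ℕ} (hk : matInd B ≤ k) :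
    ∃ Y, B ^ matInd B = B ^ k * Y := by
  obtain ⟨Y, hY⟩ := exists_eq_mul_of_mrange_le (mrange_pow_matInd_succ B).ge
  induction k, hk using Nat.le_induction with
  | base => exact ⟨1, (mul_one _).symm⟩
  | succ k hk ih =>
    obtain ⟨Z, hZ⟩ := ih
    obtain ⟨c, rfl⟩ := Nat.exists_eq_add_of_le' hk
    refine ⟨Y * Z, ?_⟩
    calc B ^ matInd B = B ^ c * B ^ matInd B * Z := by rw [← pow_add, ← hZ]
      _ = B ^ c * (B ^ (matInd B + 1) * Y) * Z := by rw [← hY]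
      _ = B ^ (c + matInd B + 1) * (Y * Z) := by simp only [add_assoc, pow_add B c, mul_assoc]

/-- The core-EP inverse `X` of `B` satisfies `B X² = X`. -/
theorem IsCoreEP.mul_mul_self {B X : Matrix ι ι ℂ} (h : IsCoreEP B X) : B * (X * X) = X := by
  obtain ⟨hXBX, hr, -⟩ := h
  obtain ⟨Z, hZ⟩ := exists_eq_mul_of_mrange_le hr.le
  obtain ⟨V, hV⟩ := exists_eq_mul_of_mrange_le hr.ge
  obtain ⟨Y, hY⟩ := exists_pow_matInd_eq_pow_mul B (Nat.le_succ _)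
  have hXB : X * B * B ^ matInd B = B ^ matInd B := by rw [hV, ← mul_assoc, hXBX]
  have hBX : B * X * B ^ matInd B = B ^ matInd B := by
    calc B * X * B ^ matInd B = B * X * (B ^ (matInd B + 1) * Y) := by rw [← hY]
      _ = B * (X * B * B ^ matInd B) * Y := by simp only [pow_succ', mul_assoc]
      _ = B ^ matInd B := by rw [hXB, ← pow_succ', ← hY]
  calc B * (X * X) = B * X * B ^ matInd B * Z := by rw [mul_assoc (B * X), ← hZ, mul_assoc]
    _ = X := by rw [hBX, ← hZ]

theorem IsCoreEP.pow_mul_pow_succ {B X : Matrix ι ι ℂ} (h : IsCoreEP B X) (m : ℕ) :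
    B ^ m * X ^ (m + 1) = X := by
  induction m with
  | zero => simp
  | succ m ih =>
    calc B ^ (m + 1) * X ^ (m + 2) = B ^ m * (B * (X * X)) * X ^ m := by
          simp only [pow_succ, pow_succ' X, mul_assoc]
      _ = X := by rw [h.mul_mul_self, mul_assoc, ← pow_succ', ih]

theorem IsCoreEP.mker_pow_succ_mul {κ : Type*} [Fintype κ] {B X : Matrix ι ι ℂ}
    (h : IsCoreEP B X) {k : ℕ} (hk : matInd B ≤ k) (m : ℕ) (M : Matrix ι κ ℂ) :
    mker (X ^ (m + 1) * M) = mker ((B ^ k)ᴴ * M) := by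
  obtain ⟨Y, hY⟩ := exists_pow_matInd_eq_pow_mul B hk
  obtain ⟨Z, hZ⟩ := exists_eq_mul_of_mrange_le h.2.2.le
  obtain ⟨V, hV⟩ := exists_eq_mul_of_mrange_le h.2.2.ge
  have hX : X = (Y * Z)ᴴ * (B ^ k)ᴴ := by
    rw [← Matrix.conjTranspose_mul, ← mul_assoc, ← hY, ← hZ, Matrix.conjTranspose_conjTranspose]
  have hB : (B ^ k)ᴴ = (V * B ^ (k - matInd B))ᴴ * B ^ m * X ^ (m + 1) := by
    rw [mul_assoc, h.pow_mul_pow_succ]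
    conv_rhs => rw [← Matrix.conjTranspose_conjTranspose X]
    rw [← Matrix.conjTranspose_mul, ← mul_assoc, ← hV, ← pow_add, Nat.add_sub_cancel' hk]
  apply le_antisymm
  · rw [hB, Matrix.mul_assoc]
    exact mker_le_mker_mul _ _
  · have hXm : X ^ (m + 1) * M = X ^ m * (Y * Z)ᴴ * ((B ^ k)ᴴ * M) := by
      rw [← Matrix.mul_assoc, Matrix.mul_assoc (X ^ m), ← hX, ← pow_succ]
    rw [hXm]
    exact mker_le_mker_mul _ _

end Index

theorem mul_pow_mul_comm {ι κ : Type*} [Fintype ι] [Fintype κ] [DecidableEq ι] [DecidableEq κ]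
    (W : Matrix ι κ ℂ) (C : Matrix κ ι ℂ) (m : ℕ) : W * (C * W) ^ m = (W * C) ^ m * W := by
  induction m with
  | zero => simp
  | succ m ih =>
    rw [pow_succ, pow_succ, ← Matrix.mul_assoc, ih]
    simp only [Matrix.mul_assoc]

theorem stmt4 {q n : ℕ} (A : Matrix (Fin q) (Fin n) ℂ) (W : Matrix (Fin n) (Fin q) ℂ)
    (hW : W ≠ 0) (m : ℕ) (hm : 0 < m) (k : ℕ)
    (hk : k = max (matInd (A * W)) (matInd (W * A)))
    (Adag : Matrix (Fin n) (Fin q) ℂ) (hAdag : IsMP A Adag)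
    (WAcep : Matrix (Fin n) (Fin n) ℂ) (hWAcep : IsCoreEP (W * A) WAcep)
    (AepW AWGm : Matrix (Fin q) (Fin n) ℂ) (AWGMP : Matrix (Fin n) (Fin q) ℂ)
    (hAepW : AepW = A * (WAcep * WAcep))
    (hAWGm : AWGm = (AepW * W) ^ m * AepW * (W * A) ^ m)
    (hAWGMP : AWGMP = W * AWGm * W * A * Adag) :
    mker AWGMP = mker (((W * A) ^ k)ᴴ * (W * A) ^ (m + 1) * Adag) := by
  have hWA : W * AepW = WAcep := by rw [hAepW, ← Matrix.mul_assoc, hWAcep.mul_mul_self]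
  have hprod : AWGMP = WAcep ^ (m + 1) * ((W * A) ^ (m + 1) * Adag) := by
    calc AWGMP = W * (AepW * W) ^ m * AepW * (W * A) ^ m * (W * A) * Adag := by
          rw [hAWGMP, hAWGm]
          simp only [Matrix.mul_assoc]
      _ = WAcep ^ m * (W * AepW) * ((W * A) ^ m * (W * A)) * Adag := by
          rw [mul_pow_mul_comm, hWA]
          simp only [← hWA, Matrix.mul_assoc]
      _ = WAcep ^ (m + 1) * ((W * A) ^ (m + 1) * Adag) := by
          rw [hWA, ← pow_succ, ← pow_succ, Matrix.mul_assoc]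
  rw [hprod, Matrix.mul_assoc]
  exact hWAcep.mker_pow_succ_mul (hk ▸ le_max_right _ _) m _
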